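/- (a) If a graph G has minimum degree exactly 1, then FTD(G) = 1. (b) If a graph G has minimum degree at least 2, then FTD(G) > 1. -/

import Mathlib

/-- The number of members of the family `F` (counted with multiplicity) containing `v`. -/
def appearCount {V : Type*} [DecidableEq V] (F : Multiset (Finset V)) (v : V) : ℕ :=
  Multiset.countP (fun S => v ∈ S) F

/-- `r_F`: the maximum, over all vertices `v`, of the number of members of `F` containing `v`. -/
def maxAppear {V : Type*} [Fintype V] [DecidableEq V] (F : Multiset (Finset V)) : ℕ :=
  Finset.univ.sup fun v : V => appearCount F v

/-- `S` is a total dominating set of `G`: every vertex of `G` has a neighbor in `S`. -/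
def IsTotalDomSet {V : Type*} (G : SimpleGraph V) (S : Finset V) : Prop :=
  ∀ v : V, ∃ u ∈ S, G.Adj v u

/-- The fractional total domatic number `FTD(G)`: the supremum of the effective ratio
`|F| / r_F` over all nonempty thoroughly distributed families `F` of `G`, i.e. finite
families (with repetition allowed) of total dominating sets of `G`. -/
noncomputable def FTD {V : Type*} [Fintype V] [DecidableEq V] (G : SimpleGraph V) : ℝ :=
  sSup { r : ℝ | ∃ F : Multiset (Finset V), F ≠ 0 ∧ (∀ S ∈ F, IsTotalDomSet G S) ∧
      r = (Multiset.card F : ℝ) / (maxAppear F : ℝ) }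

lemma appear_le_max {V : Type*} [Fintype V] [DecidableEq V] (F : Multiset (Finset V)) (v : V) :
    appearCount F v ≤ maxAppear F :=
  Finset.le_sup (f := fun v : V => appearCount F v) (Finset.mem_univ v)

lemma max_le_card {V : Type*} [Fintype V] [DecidableEq V] (F : Multiset (Finset V)) :
    maxAppear F ≤ Multiset.card F :=
  Finset.sup_le fun _ _ => Multiset.countP_le_card _ _

lemma card_le_sum_appear {V : Type*} [Fintype V] [DecidableEq V] (F : Multiset (Finset V))
    (h : ∀ S ∈ F, S.Nonempty) : Multiset.card F ≤ ∑ v : V, appearCount F v := by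
  induction F using Multiset.induction_on with
  | empty => simp
  | cons S F ih =>
    have h1 := ih fun T hT => h T (Multiset.mem_cons_of_mem hT)
    have h2 : 1 ≤ S.card := Finset.card_pos.mpr (h S (Multiset.mem_cons_self S F))
    simp only [appearCount, Multiset.countP_cons, Multiset.card_cons, Finset.sum_add_distrib] at h1 ⊢
    have h3 : ∑ v : V, (if v ∈ S then 1 else 0) = S.card := by simp
    omega

lemma card_le_mul_max {V : Type*} [Fintype V] [DecidableEq V] (F : Multiset (Finset V))
    (h : ∀ S ∈ F, S.Nonempty) : Multiset.card F ≤ Fintype.card V * maxAppear F := by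
  refine (card_le_sum_appear F h).trans ?_
  refine (Finset.sum_le_sum fun v _ => appear_le_max F v).trans ?_
  simp

theorem stmt4 :
    (∀ (V : Type) [Fintype V] [DecidableEq V] (G : SimpleGraph V) [DecidableRel G.Adj],
      G.minDegree = 1 → FTD G = 1) ∧
    (∀ (V : Type) [Fintype V] [DecidableEq V] (G : SimpleGraph V) [DecidableRel G.Adj],
      2 ≤ G.minDegree → 1 < FTD G) := by
  constructor
  · intro V _ _ G _ hG
    have hne : Nonempty V := by
      by_contra hc
      rw [not_nonempty_iff] at hc
      simp [SimpleGraph.minDegree_of_isEmpty] at hG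
    obtain ⟨v, hv⟩ := G.exists_minimal_degree_vertex
    have hdeg : G.degree v = 1 := by omega
    obtain ⟨u, hu⟩ := Finset.card_eq_one.mp hdeg
    have huniq : ∀ w, G.Adj v w → w = u := by
      intro w hw
      have : w ∈ G.neighborFinset v := by simpa using hw
      rw [hu] at this
      simpa using this
    have key : { r : ℝ | ∃ F : Multiset (Finset V), F ≠ 0 ∧ (∀ S ∈ F, IsTotalDomSet G S) ∧
      r = (Multiset.card F : ℝ) / (maxAppear F : ℝ) } = {1} := by
      have all : ∀ F : Multiset (Finset V), F ≠ 0 → (∀ S ∈ F, IsTotalDomSet G S) →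
          (Multiset.card F : ℝ) / (maxAppear F : ℝ) = 1 := by
        intro F hF hd
        have h1 : appearCount F u = Multiset.card F := by
          unfold appearCount
          rw [Multiset.countP_eq_card]
          intro S hS
          obtain ⟨w, hw, ha⟩ := hd S hS v
          rwa [← huniq w ha]
        have h2 := appear_le_max F u
        have h3 := max_le_card F
        have h4 : maxAppear F = Multiset.card F := by omega
        rw [h4]
        exact div_self (by simpa using hF)
      ext r
      constructor
      · rintro ⟨F, hF, hd, rfl⟩
        exact all F hF hd
      · rintro rfl
        have hd : ∀ S ∈ ({Finset.univ} : Multiset (Finset V)), IsTotalDomSet G S := by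
          intro S hS
          rw [Multiset.mem_singleton] at hS
          subst hS
          intro w
          have : 0 < G.degree w := by
            have := G.minDegree_le_degree w
            omega
          obtain ⟨x, hx⟩ := (G.degree_pos_iff_exists_adj w).mp this
          exact ⟨x, Finset.mem_univ _, hx⟩
        exact ⟨{Finset.univ}, by simp, hd, (all _ (by simp) hd).symm⟩
    unfold FTD
    rw [key, csSup_singleton]
  · intro V _ _ G _ hG
    have hne : Nonempty V := by
      by_contra hc
      rw [not_nonempty_iff] at hc
      simp [SimpleGraph.minDegree_of_isEmpty] at hG
    have hn : 2 ≤ Fintype.card V := by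
      obtain ⟨v⟩ := hne
      have h1 := G.minDegree_le_degree v
      have h2 := G.degree_lt_card_verts v
      omega
    let F : Multiset (Finset V) := (Finset.univ : Finset V).val.map fun v => Finset.univ.erase v
    have hcard : Multiset.card F = Fintype.card V := by
      simp [F]
    have happ : ∀ v, appearCount F v = Fintype.card V - 1 := by
      intro v
      simp only [appearCount, F, Multiset.countP_map]
      change (Finset.univ.filter fun w => v ∈ Finset.univ.erase w).card = _
      have : (Finset.univ.filter fun w => v ∈ Finset.univ.erase w) = Finset.univ.erase v := by
        ext w
        simp [eq_comm]
      rw [this, Finset.card_erase_of_mem (Finset.mem_univ _), Finset.card_univ]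
    have hmax : maxAppear F = Fintype.card V - 1 := by
      unfold maxAppear
      simp only [happ]
      exact Finset.sup_const Finset.univ_nonempty _
    have hd : ∀ S ∈ F, IsTotalDomSet G S := by
      intro S hS
      obtain ⟨x, -, rfl⟩ := Multiset.mem_map.mp hS
      intro w
      have h1 : 1 < (G.neighborFinset w).card := by
        have := G.minDegree_le_degree w
        rw [G.card_neighborFinset_eq_degree]
        omega
      obtain ⟨y, hy, hyx⟩ := Finset.exists_mem_ne h1 x
      exact ⟨y, by simpa using hyx, by simpa using hy⟩
    have hlt : (1 : ℝ) < (Multiset.card F : ℝ) / (maxAppear F : ℝ) := by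
      rw [hcard, hmax, one_lt_div]
      · exact_mod_cast (by omega : Fintype.card V - 1 < Fintype.card V)
      · exact_mod_cast (by omega : 0 < Fintype.card V - 1)
    refine hlt.trans_le (le_csSup ⟨(Fintype.card V : ℝ), ?_⟩ ⟨F, ?_, hd, rfl⟩)
    · rintro r ⟨E, -, hE, rfl⟩
      refine div_le_of_le_mul₀ (by positivity) (by positivity) ?_
      have := card_le_mul_max E fun S hS => by
        obtain ⟨w, hw, -⟩ := hE S hS hne.some
        exact ⟨w, hw⟩
      exact_mod_cast this
    · intro h0
      rw [h0] at hcard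
      simp at hcard
      omega
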